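/- Let G be a finite simple graph on n ≥ 2 vertices in which every vertex has degree at most Δmax, let t ≥ 1 be an integer, and let c be an edge colouring of G with colours {1,…,t} (not necessarily proper). Suppose 0 < ε ≤ 1/2 and η is a real number with 1 ≤ η ≤ (ε²/(128·ln n))·(Δmax/t), and suppose the local invariant holds: for every edge uv of G and every colour i ∈ {1,…,t}, s_{c(uv)}(u) + s_{c(uv)}(v) ≤ η + s_i(u) + s_i(v). Then for every vertex v and every colour i ∈ {1,…,t}, the number of edges of colour i incident to v satisfies d_i(v) ≤ (1+ε)·Δmax/t. -/

import Mathlib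

open Finset

/-- The number of edges of colour `i` incident to the vertex `v`
(in a simple graph, with an edge colouring `c`, not necessarily proper). -/
def colDeg {V : Type*} [Fintype V] [DecidableEq V] (G : SimpleGraph V) [DecidableRel G.Adj]
    (c : Sym2 V → ℕ) (i : ℕ) (v : V) : ℕ :=
  ((G.neighborFinset v).filter (fun u => c s(v, u) = i)).card

/-- The surplus `s_i(v) = max (d_i(v) - Δmax / t) 0` of colour `i` at the vertex `v`. -/
noncomputable def surplus {V : Type*} [Fintype V] [DecidableEq V] (G : SimpleGraph V)
    [DecidableRel G.Adj] (c : Sym2 V → ℕ) (Δmax t : ℕ) (i : ℕ) (v : V) : ℝ :=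
  max ((colDeg G c i v : ℝ) - (Δmax : ℝ) / (t : ℝ)) 0

theorem sum_colDeg_le_degree {V : Type*} [Fintype V] [DecidableEq V] (G : SimpleGraph V)
    [DecidableRel G.Adj] (c : Sym2 V → ℕ) (I : Finset ℕ) (v : V) :
    ∑ i ∈ I, colDeg G c i v ≤ G.degree v := by
  unfold colDeg
  rw [← Finset.card_biUnion, ← G.card_neighborFinset_eq_degree]
  · exact Finset.card_le_card (Finset.biUnion_subset.2 fun i _ => Finset.filter_subset _ _)
  · intro i _ j _ hij
    exact Finset.disjoint_filter.2 fun u _ h h' => hij (h.symm.trans h')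

/-- Double counting of the ordered adjacent pairs of colour `j`. -/
theorem sum_sum_neighbor_eq_sum_colDeg_mul {V : Type*} [Fintype V] [DecidableEq V]
    (G : SimpleGraph V) [DecidableRel G.Adj] (c : Sym2 V → ℕ) (j : ℕ) (f : V → ℝ) :
    ∑ v, ∑ w ∈ (G.neighborFinset v).filter (fun w => c s(v, w) = j), f w
      = ∑ w, (colDeg G c j w : ℝ) * f w := by
  rw [Finset.sum_comm' (t' := Finset.univ)
    (s' := fun w => (G.neighborFinset w).filter (fun v => c s(w, v) = j))]
  · refine Finset.sum_congr rfl fun w _ => ?_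
    rw [Finset.sum_const, nsmul_eq_mul, colDeg]
  · intro v w
    simp [G.adj_comm v w, Sym2.eq_swap (a := v) (b := w)]

section
variable {V : Type*} [Fintype V] [DecidableEq V] (G : SimpleGraph V) [DecidableRel G.Adj]
  (c : Sym2 V → ℕ) (Δmax t : ℕ)

theorem surplus_nonneg (i : ℕ) (v : V) : 0 ≤ surplus G c Δmax t i v :=
  le_max_right _ _

/-- Exponentially damping the colours in surplus keeps the average colour degree below
`Δmax / t`. -/
theorem sum_colDeg_mul_exp_neg_surplus_le (ht : 1 ≤ t) {β : ℝ} (hβ : 0 ≤ β) {v : V}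
    (hdeg : G.degree v ≤ Δmax) :
    ∑ j ∈ Finset.Icc 1 t, (colDeg G c j v : ℝ) * Real.exp (-(β * surplus G c Δmax t j v))
      ≤ (Δmax : ℝ) / t * ∑ j ∈ Finset.Icc 1 t, Real.exp (-(β * surplus G c Δmax t j v)) := by
  have ht' : (0 : ℝ) < t := by exact_mod_cast ht
  have hterm : ∀ j ∈ Finset.Icc 1 t,
      (colDeg G c j v : ℝ) * Real.exp (-(β * surplus G c Δmax t j v))
        ≤ (Δmax : ℝ) / t * Real.exp (-(β * surplus G c Δmax t j v))
          + ((colDeg G c j v : ℝ) - (Δmax : ℝ) / t) := by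
    intro j _
    rcases le_total ((colDeg G c j v : ℝ) - (Δmax : ℝ) / t) 0 with h | h
    · have : surplus G c Δmax t j v = 0 := max_eq_right h
      simp [this]
    · have : Real.exp (-(β * surplus G c Δmax t j v)) ≤ 1 :=
        Real.exp_le_one_iff.2 (neg_nonpos.2 (mul_nonneg hβ (surplus_nonneg ..)))
      nlinarith
  have hsum : ∑ j ∈ Finset.Icc 1 t, ((colDeg G c j v : ℝ) - (Δmax : ℝ) / t) ≤ 0 := by
    rw [Finset.sum_sub_distrib, Finset.sum_const, Nat.card_Icc, nsmul_eq_mul]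
    have h : (∑ j ∈ Finset.Icc 1 t, (colDeg G c j v : ℝ)) ≤ Δmax := by
      exact_mod_cast (sum_colDeg_le_degree G c (Finset.Icc 1 t) v).trans hdeg
    have : ((t + 1 - 1 : ℕ) : ℝ) * ((Δmax : ℝ) / t) = Δmax := by
      rw [Nat.add_sub_cancel]; field_simp
    linarith
  have := Finset.sum_le_sum hterm
  rw [Finset.sum_add_distrib, ← Finset.mul_sum] at this
  linarith

/-- Some colour has no surplus at a vertex of degree at most `Δmax`. -/
theorem exists_surplus_eq_zero (ht : 1 ≤ t) {v : V} (hdeg : G.degree v ≤ Δmax) :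
    ∃ i ∈ Finset.Icc 1 t, surplus G c Δmax t i v = 0 := by
  have ht' : (0 : ℝ) < t := by exact_mod_cast ht
  obtain ⟨i, hi, h⟩ := Finset.exists_le_of_sum_le (s := Finset.Icc 1 t)
    (f := fun i => (colDeg G c i v : ℝ)) (g := fun _ => (Δmax : ℝ) / t) ⟨1, by simp [ht]⟩ (by
      rw [Finset.sum_const, Nat.card_Icc, nsmul_eq_mul, Nat.add_sub_cancel,
        mul_div_cancel₀ _ ht'.ne']
      exact_mod_cast (sum_colDeg_le_degree G c (Finset.Icc 1 t) v).trans hdeg)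
  exact ⟨i, hi, max_eq_right (sub_nonpos.2 h)⟩

variable {G c Δmax t}

theorem one_le_colDeg_of_surplus_pos {i : ℕ} {v : V} (h : 0 < surplus G c Δmax t i v) :
    1 ≤ colDeg G c i v := by
  by_contra! h0
  have : colDeg G c i v = 0 := by omega
  have h2 : (0 : ℝ) ≤ (Δmax : ℝ) / t := by positivity
  simp [surplus, this, h2] at h

/-- An edge whose colour has surplus more than `η` forces every colour to appear at one of its
ends, so there are fewer than `2 |V|` colours. -/
theorem colours_le_two_mul_card {η : ℝ} {u v : V}
    (hinv : ∀ i ∈ Finset.Icc 1 t,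
      surplus G c Δmax t (c s(u, v)) u + surplus G c Δmax t (c s(u, v)) v
        ≤ η + surplus G c Δmax t i u + surplus G c Δmax t i v)
    (hη : η < surplus G c Δmax t (c s(u, v)) u) : t ≤ 2 * Fintype.card V := by
  have key : ∀ i ∈ Finset.Icc 1 t, 1 ≤ colDeg G c i u + colDeg G c i v := by
    intro i hi
    have h := hinv i hi
    have h0 := surplus_nonneg G c Δmax t (c s(u, v)) v
    rcases lt_or_ge 0 (surplus G c Δmax t i u) with hu | hu
    · have := one_le_colDeg_of_surplus_pos hu; omega
    · have hv : 0 < surplus G c Δmax t i v := by linarith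
      have := one_le_colDeg_of_surplus_pos hv; omega
  have h1 := Finset.sum_le_sum key
  rw [Finset.sum_add_distrib] at h1
  simp only [Finset.sum_const, Nat.card_Icc, smul_eq_mul, mul_one, Nat.add_sub_cancel] at h1
  have hu := (sum_colDeg_le_degree G c (Finset.Icc 1 t) u).trans (G.degree_lt_card_verts u).le
  have hv := (sum_colDeg_le_degree G c (Finset.Icc 1 t) v).trans (G.degree_lt_card_verts v).le
  omega

/-- The local invariant in exponential form. -/
theorem exp_surplus_mul_sum_le {β η : ℝ} (hβ : 0 ≤ β) {u v : V}
    (hinv : ∀ i ∈ Finset.Icc 1 t,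
      surplus G c Δmax t (c s(v, u)) v + surplus G c Δmax t (c s(v, u)) u
        ≤ η + surplus G c Δmax t i v + surplus G c Δmax t i u) :
    (∑ i ∈ Finset.Icc 1 t, Real.exp (-(β * surplus G c Δmax t i v)))
        * Real.exp (β * surplus G c Δmax t (c s(v, u)) v)
      ≤ Real.exp (β * η) * ((∑ i ∈ Finset.Icc 1 t, Real.exp (β * surplus G c Δmax t i u))
        * Real.exp (-(β * surplus G c Δmax t (c s(v, u)) u))) := by
  rw [Finset.sum_mul, Finset.sum_mul, Finset.mul_sum]
  refine Finset.sum_le_sum fun i hi => ?_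
  rw [← Real.exp_add, ← Real.exp_add, ← Real.exp_add, Real.exp_le_exp]
  nlinarith [mul_le_mul_of_nonneg_left (hinv i hi) hβ]

/-- The total potential of the pairs with surplus at least `x`, scaled by their degree, is at most
`exp (β η) Δmax / t` times the total potential. -/
theorem potential_le {β η x : ℝ} (hβ : 0 ≤ β) (hx : 0 < x) (ht : 1 ≤ t)
    (hdeg : ∀ v, G.degree v ≤ Δmax)
    (hinv : ∀ u v, G.Adj u v → ∀ i ∈ Finset.Icc 1 t,
      surplus G c Δmax t (c s(u, v)) u + surplus G c Δmax t (c s(u, v)) v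
        ≤ η + surplus G c Δmax t i u + surplus G c Δmax t i v) :
    ((Δmax : ℝ) / t + x) * ∑ v, ∑ j ∈ (Finset.Icc 1 t).filter (x ≤ surplus G c Δmax t · v),
        (∑ i ∈ Finset.Icc 1 t, Real.exp (-(β * surplus G c Δmax t i v)))
          * Real.exp (β * surplus G c Δmax t j v)
      ≤ Real.exp (β * η) * ((Δmax : ℝ) / t * ∑ v,
        (∑ i ∈ Finset.Icc 1 t, Real.exp (-(β * surplus G c Δmax t i v)))
          * ∑ i ∈ Finset.Icc 1 t, Real.exp (β * surplus G c Δmax t i v)) := by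
  set R : V → ℝ := fun v => ∑ i ∈ Finset.Icc 1 t, Real.exp (-(β * surplus G c Δmax t i v))
  set W : V → ℝ := fun v => ∑ i ∈ Finset.Icc 1 t, Real.exp (β * surplus G c Δmax t i v)
  have hR : ∀ v, 0 ≤ R v := fun v => Finset.sum_nonneg fun i _ => (Real.exp_pos _).le
  have hW : ∀ v, 0 ≤ W v := fun v => Finset.sum_nonneg fun i _ => (Real.exp_pos _).le
  set F : ℕ → V → ℝ := fun j w => W w * Real.exp (-(β * surplus G c Δmax t j w))
  have hF : ∀ j w, 0 ≤ F j w := fun j w => mul_nonneg (hW w) (Real.exp_pos _).le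
  calc ((Δmax : ℝ) / t + x) * ∑ v, ∑ j ∈ (Finset.Icc 1 t).filter (x ≤ surplus G c Δmax t · v),
        R v * Real.exp (β * surplus G c Δmax t j v)
      = ∑ v, ∑ j ∈ (Finset.Icc 1 t).filter (x ≤ surplus G c Δmax t · v),
        ((Δmax : ℝ) / t + x) * (R v * Real.exp (β * surplus G c Δmax t j v)) := by
        simp_rw [Finset.mul_sum]
    _ ≤ ∑ v, ∑ j ∈ (Finset.Icc 1 t).filter (x ≤ surplus G c Δmax t · v),
        ∑ w ∈ (G.neighborFinset v).filter (fun w => c s(v, w) = j),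
          Real.exp (β * η) * F j w := by
        refine Finset.sum_le_sum fun v _ => Finset.sum_le_sum fun j hj => ?_
        have hxj := (Finset.mem_filter.1 hj).2
        have hd : (Δmax : ℝ) / t + x ≤ colDeg G c j v := by
          rcases le_max_iff.1 hxj with h | h <;> linarith
        refine (mul_le_mul_of_nonneg_right hd
          (mul_nonneg (hR v) (Real.exp_pos _).le)).trans ?_
        rw [colDeg, ← nsmul_eq_mul]
        refine Finset.card_nsmul_le_sum _ _ _ fun w hw => ?_
        obtain ⟨hvw, rfl⟩ := Finset.mem_filter.1 hw
        exact exp_surplus_mul_sum_le hβ (hinv v w ((G.mem_neighborFinset v w).1 hvw))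
    _ ≤ ∑ v, ∑ j ∈ Finset.Icc 1 t,
        ∑ w ∈ (G.neighborFinset v).filter (fun w => c s(v, w) = j),
          Real.exp (β * η) * F j w :=
        Finset.sum_le_sum fun v _ => Finset.sum_le_sum_of_subset_of_nonneg
          (Finset.filter_subset _ _) fun j _ _ => Finset.sum_nonneg fun w _ =>
            mul_nonneg (Real.exp_pos _).le (hF j w)
    _ = Real.exp (β * η) * ∑ w, W w * ∑ j ∈ Finset.Icc 1 t,
          (colDeg G c j w : ℝ) * Real.exp (-(β * surplus G c Δmax t j w)) := by
        rw [Finset.sum_comm]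
        simp_rw [sum_sum_neighbor_eq_sum_colDeg_mul]
        rw [Finset.sum_comm, Finset.mul_sum]
        refine Finset.sum_congr rfl fun w _ => ?_
        rw [Finset.mul_sum, Finset.mul_sum]
        refine Finset.sum_congr rfl fun j _ => ?_
        ring
    _ ≤ Real.exp (β * η) * ∑ w, W w * ((Δmax : ℝ) / t * R w) := by
        gcongr with w _
        · exact sum_colDeg_mul_exp_neg_surplus_le G c Δmax t ht hβ (hdeg w)
    _ = Real.exp (β * η) * ((Δmax : ℝ) / t * ∑ v, R v * W v) := by
        rw [Finset.mul_sum (a := (Δmax : ℝ) / t)]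
        congr 1
        refine Finset.sum_congr rfl fun w _ => ?_
        ring

/-- The pairs with surplus below `x` contribute at most `|V| t² exp (β x)` to the potential. -/
theorem total_potential_le {β x : ℝ} (hβ : 0 ≤ β) :
    (∑ v, (∑ i ∈ Finset.Icc 1 t, Real.exp (-(β * surplus G c Δmax t i v)))
          * ∑ i ∈ Finset.Icc 1 t, Real.exp (β * surplus G c Δmax t i v))
      ≤ (∑ v, ∑ j ∈ (Finset.Icc 1 t).filter (x ≤ surplus G c Δmax t · v),
        (∑ i ∈ Finset.Icc 1 t, Real.exp (-(β * surplus G c Δmax t i v)))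
          * Real.exp (β * surplus G c Δmax t j v))
        + Fintype.card V * ((t : ℝ) * (t * Real.exp (β * x))) := by
  have hconst : (Fintype.card V : ℝ) * ((t : ℝ) * (t * Real.exp (β * x)))
      = ∑ _v : V, (t : ℝ) * (t * Real.exp (β * x)) := by
    simp
  rw [hconst, ← Finset.sum_add_distrib]
  refine Finset.sum_le_sum fun v _ => ?_
  set R : ℝ := ∑ i ∈ Finset.Icc 1 t, Real.exp (-(β * surplus G c Δmax t i v))
  have hR : 0 ≤ R := Finset.sum_nonneg fun i _ => (Real.exp_pos _).le
  have hRt : R ≤ t := by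
    have := Finset.sum_le_card_nsmul (Finset.Icc 1 t)
      (fun i => Real.exp (-(β * surplus G c Δmax t i v))) 1 fun i _ =>
        Real.exp_le_one_iff.2 (neg_nonpos.2 (mul_nonneg hβ (surplus_nonneg ..)))
    simpa using this
  rw [← Finset.mul_sum, ← Finset.sum_filter_add_sum_filter_not (Finset.Icc 1 t)
    (x ≤ surplus G c Δmax t · v), mul_add]
  gcongr
  refine (Finset.sum_le_card_nsmul _ _ (Real.exp (β * x)) fun i hi => ?_).trans ?_
  · have := not_le.1 (Finset.mem_filter.1 hi).2
    gcongr
  · rw [nsmul_eq_mul]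
    gcongr
    simpa using Finset.card_filter_le (Finset.Icc 1 t) fun i => ¬ x ≤ surplus G c Δmax t i v

end

/-- The bounds on the potential are incompatible with a large maximum surplus. -/
theorem false_of_potential_bounds {n ε t E Q H : ℝ} (hε0 : 0 < ε) (hε : ε ≤ 1 / 2) (hn : 2 ≤ n)
    (hεn : 64 ≤ ε ^ 2 * n) (ht : 0 ≤ t) (htn : t ≤ 2 * n) (hEn : n ^ 8 ≤ E) (hQlow : E * E ≤ Q)
    (hQH : (1 + ε / 2) * Q ≤ (1 + ε / 4) * H) (htot : H ≤ Q + n * (t * (t * E))) : False := by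
  have hn0 : 0 < n := by linarith
  have hE0 : 0 < E := lt_of_lt_of_le (by positivity) hEn
  have hB : n * (t * (t * E)) ≤ 4 * n ^ 3 * E := by
    calc n * (t * (t * E)) ≤ n * (2 * n * (2 * n * E)) := by gcongr
      _ = 4 * n ^ 3 * E := by ring
  have hQB : ε / 4 * Q ≤ (1 + ε / 4) * (4 * n ^ 3 * E) := by
    have : (1 + ε / 4) * H ≤ (1 + ε / 4) * (Q + 4 * n ^ 3 * E) := by gcongr; linarith
    linarith
  have hcontr : ε / 4 * n ^ 8 ≤ (1 + ε / 4) * (4 * n ^ 3) := by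
    refine le_of_mul_le_mul_right ?_ hE0
    calc ε / 4 * n ^ 8 * E ≤ ε / 4 * E * E := by gcongr
      _ ≤ ε / 4 * Q := by rw [mul_assoc]; gcongr
      _ ≤ _ := by linarith
  have h32 : 32 ≤ ε * n := by nlinarith [mul_pos hε0 hn0]
  have hn3 : 0 < n ^ 3 := by positivity
  have hn4 : 1 ≤ n ^ 4 := one_le_pow₀ (by linarith)
  have h8 : 8 ≤ ε * n / 4 * n ^ 4 := by nlinarith
  nlinarith [mul_le_mul_of_nonneg_right h8 hn3.le]

/-- If the local invariant holds everywhere, then every colour class has maximum degree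
at most `(1 + ε) Δmax / t`. -/
theorem tSplitterDegreeBound {V : Type*} [Fintype V] [DecidableEq V]
    (G : SimpleGraph V) [DecidableRel G.Adj]
    (Δmax t : ℕ) (c : Sym2 V → ℕ) (ε η : ℝ)
    (hn : 2 ≤ Fintype.card V)
    (hdeg : ∀ v, G.degree v ≤ Δmax)
    (ht : 1 ≤ t)
    (hcol : ∀ u v, G.Adj u v → c s(u, v) ∈ Finset.Icc 1 t)
    (hε0 : 0 < ε) (hε : ε ≤ 1 / 2)
    (hη1 : 1 ≤ η)
    (hη2 : η ≤ ε ^ 2 / (128 * Real.log (Fintype.card V)) * ((Δmax : ℝ) / (t : ℝ)))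
    (hinv : ∀ u v, G.Adj u v → ∀ i ∈ Finset.Icc 1 t,
      surplus G c Δmax t (c s(u, v)) u + surplus G c Δmax t (c s(u, v)) v
        ≤ η + surplus G c Δmax t i u + surplus G c Δmax t i v) :
    ∀ v, ∀ i ∈ Finset.Icc 1 t,
      (colDeg G c i v : ℝ) ≤ (1 + ε) * (Δmax : ℝ) / (t : ℝ) := by
  intro v i hi
  by_contra! hlt
  set n := Fintype.card V
  set a : ℝ := (Δmax : ℝ) / t
  have hn2 : (2 : ℝ) ≤ n := by exact_mod_cast hn
  have hlog : 1 / 2 ≤ Real.log n :=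
    (by linarith [Real.log_two_gt_d9] : 1 / 2 ≤ Real.log 2).trans
      (Real.log_le_log (by norm_num) hn2)
  have hlog0 : 0 < Real.log n := by linarith
  have hεa : 128 * Real.log n * η ≤ ε ^ 2 * a := by
    rw [div_mul_eq_mul_div, le_div_iff₀ (by positivity)] at hη2
    linarith
  have hεa' : 64 * η ≤ ε ^ 2 * a := by nlinarith
  have ha : 0 < a := by
    have : 0 < ε ^ 2 * a := by linarith
    exact pos_of_mul_pos_right this (sq_nonneg ε)
  have hd : a + ε * a < colDeg G c i v := by
    rw [mul_div_assoc] at hlt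
    linarith
  have hs : ε * a < surplus G c Δmax t i v := lt_max_of_lt_left (by linarith)
  have hηx : η < ε * a / 2 := by nlinarith [mul_pos hε0 ha]
  have han : a < n := by
    have h1 : colDeg G c i v ≤ n :=
      (Finset.card_filter_le _ _).trans (Finset.card_le_univ _)
    have h2 : (colDeg G c i v : ℝ) ≤ n := by exact_mod_cast h1
    nlinarith [mul_pos hε0 ha]
  have hεn : 64 ≤ ε ^ 2 * n := by nlinarith [sq_pos_of_pos hε0]
  have htn : (t : ℝ) ≤ 2 * n := by
    have hpos : 0 < colDeg G c i v := by
      have : (0 : ℝ) < colDeg G c i v := by nlinarith [mul_pos hε0 ha]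
      exact_mod_cast this
    obtain ⟨u, hu⟩ := Finset.card_pos.1 hpos
    obtain ⟨hvu, rfl⟩ := Finset.mem_filter.1 hu
    exact_mod_cast colours_le_two_mul_card (hinv v u ((G.mem_neighborFinset v u).1 hvu))
      (by nlinarith [mul_pos hε0 ha])
  set β : ℝ := ε / (8 * η) with hβ_def
  have hβ : 0 < β := by positivity
  have hβη : β * η = ε / 8 := by rw [hβ_def]; field_simp
  have hexp : Real.exp (β * η) ≤ 1 + ε / 4 := by
    rw [hβη]
    have h := Real.abs_exp_sub_one_le (x := ε / 8) (by rw [abs_of_pos] <;> linarith)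
    rw [abs_of_pos (by positivity : 0 < ε / 8)] at h
    linarith [le_abs_self (Real.exp (ε / 8) - 1)]
  have hpot := potential_le (x := ε * a / 2) hβ.le (by positivity) ht hdeg hinv
  have htot := total_potential_le (G := G) (c := c) (Δmax := Δmax) (t := t) (x := ε * a / 2) hβ.le
  set Q : ℝ := ∑ v, ∑ j ∈ (Finset.Icc 1 t).filter (ε * a / 2 ≤ surplus G c Δmax t · v),
    (∑ i ∈ Finset.Icc 1 t, Real.exp (-(β * surplus G c Δmax t i v)))
      * Real.exp (β * surplus G c Δmax t j v)
  set H : ℝ := ∑ v, (∑ i ∈ Finset.Icc 1 t, Real.exp (-(β * surplus G c Δmax t i v)))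
    * ∑ i ∈ Finset.Icc 1 t, Real.exp (β * surplus G c Δmax t i v)
  have hH : 0 ≤ H := Finset.sum_nonneg fun v _ => mul_nonneg
    (Finset.sum_nonneg fun i _ => (Real.exp_pos _).le)
    (Finset.sum_nonneg fun i _ => (Real.exp_pos _).le)
  have hQlow : Real.exp (β * (ε * a)) ≤ Q := by
    obtain ⟨k, hk, hk0⟩ := exists_surplus_eq_zero G c Δmax t ht (hdeg v)
    have hR : 1 ≤ ∑ i ∈ Finset.Icc 1 t, Real.exp (-(β * surplus G c Δmax t i v)) := by
      have := Finset.single_le_sum (f := fun i => Real.exp (-(β * surplus G c Δmax t i v)))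
        (fun i _ => (Real.exp_pos _).le) hk
      simpa [hk0] using this
    have hnn : ∀ v j, 0 ≤ (∑ i ∈ Finset.Icc 1 t, Real.exp (-(β * surplus G c Δmax t i v)))
        * Real.exp (β * surplus G c Δmax t j v) := fun v j =>
      mul_nonneg (Finset.sum_nonneg fun i _ => (Real.exp_pos _).le) (Real.exp_pos _).le
    calc Real.exp (β * (ε * a)) ≤ Real.exp (β * surplus G c Δmax t i v) := by gcongr
      _ ≤ (∑ i ∈ Finset.Icc 1 t, Real.exp (-(β * surplus G c Δmax t i v)))
          * Real.exp (β * surplus G c Δmax t i v) :=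
        le_mul_of_one_le_left (Real.exp_pos _).le hR
      _ ≤ ∑ j ∈ (Finset.Icc 1 t).filter (ε * a / 2 ≤ surplus G c Δmax t · v),
          (∑ i ∈ Finset.Icc 1 t, Real.exp (-(β * surplus G c Δmax t i v)))
            * Real.exp (β * surplus G c Δmax t j v) :=
        Finset.single_le_sum (f := fun j =>
          (∑ i ∈ Finset.Icc 1 t, Real.exp (-(β * surplus G c Δmax t i v)))
            * Real.exp (β * surplus G c Δmax t j v)) (fun j _ => hnn v j)
          (Finset.mem_filter.2 ⟨hi, by nlinarith [mul_pos hε0 ha]⟩)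
      _ ≤ Q := Finset.single_le_sum (f := fun v =>
          ∑ j ∈ (Finset.Icc 1 t).filter (ε * a / 2 ≤ surplus G c Δmax t · v),
          (∑ i ∈ Finset.Icc 1 t, Real.exp (-(β * surplus G c Δmax t i v)))
            * Real.exp (β * surplus G c Δmax t j v))
          (fun v _ => Finset.sum_nonneg fun j _ => hnn v j) (Finset.mem_univ v)
  have hEn : (n : ℝ) ^ 8 ≤ Real.exp (β * (ε * a / 2)) := by
    rw [← Real.log_le_iff_le_exp (by positivity), Real.log_pow, hβ_def,
      div_mul_eq_mul_div, le_div_iff₀ (by positivity)]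
    push_cast
    linarith
  have hQH : (1 + ε / 2) * Q ≤ (1 + ε / 4) * H := by
    refine le_of_mul_le_mul_left ?_ ha
    calc a * ((1 + ε / 2) * Q) = (a + ε * a / 2) * Q := by ring
      _ ≤ Real.exp (β * η) * (a * H) := hpot
      _ ≤ (1 + ε / 4) * (a * H) := by gcongr
      _ = a * ((1 + ε / 4) * H) := by ring
  have hEE : Real.exp (β * (ε * a))
      = Real.exp (β * (ε * a / 2)) * Real.exp (β * (ε * a / 2)) := by
    rw [← Real.exp_add]; congr 1; ring
  exact false_of_potential_bounds hε0 hε hn2 hεn (Nat.cast_nonneg t) htn hEn (hEE ▸ hQlow) hQH htot
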